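/- Let X be an O-regular compact set in C^n (O_X is closed), let phi be a real-valued continuous function on B_X, and define u = sup{ v : v in PSH^c(X), v <= phi on B_X }. Then: (1) u is lower semicontinuous and weakly plurisubharmonic on X; (2) for every z in X, u(z) = inf{ mu(phi) : mu in J_z^b(X) }; (3) for every z in X there is mu in J_z^b(X) with u(z) = mu(u); (4) u = phi on B_X and lim of u(z) as z -> z_0 equals phi(z_0) for every z_0 in B_X; (5) u is maximal on X. -/

import Mathlib

open MeasureTheory Metric Filter Topology Set Complex
open scoped ENNReal

noncomputable section

/-- `ℂⁿ`. -/
abbrev En (n : ℕ) : Type := EuclideanSpace ℂ (Fin n)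

instance (n : ℕ) : MeasurableSpace (En n) := borel _

instance (n : ℕ) : BorelSpace (En n) := ⟨rfl⟩

open Classical in
/-- The positive part of an extended real number, as an element of `ℝ≥0∞`. -/
def epos (x : EReal) : ℝ≥0∞ := if x = ⊤ then ⊤ else ENNReal.ofReal x.toReal

/-- The integral of an `EReal`-valued function `u` against a measure `μ`, defined as the
difference of the lower integrals of the positive and negative parts of `u`. -/
def eint {α : Type*} [MeasurableSpace α] (μ : Measure α) (u : α → EReal) : EReal :=
  ((∫⁻ x, epos (u x) ∂μ : ℝ≥0∞) : EReal) - ((∫⁻ x, epos (-(u x)) ∂μ : ℝ≥0∞) : EReal)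

/-- The normalized angular measure `(2π)⁻¹ dθ` on `[0, 2π)`. -/
def thetaM : Measure ℝ :=
  (ENNReal.ofReal ((2 * Real.pi)⁻¹)) • (volume.restrict (Set.Ico (0 : ℝ) (2 * Real.pi)))

/-- A function `u` with values in `[-∞, ∞)` is plurisubharmonic on an open set `U ⊆ ℂⁿ`:
it is upper semicontinuous, `< ⊤`, and satisfies the sub-mean-value inequality on every
complex line. -/
def PshOnE {n : ℕ} (u : En n → EReal) (U : Set (En n)) : Prop :=
  UpperSemicontinuousOn u U ∧ (∀ z ∈ U, u z < ⊤) ∧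
  ∀ z ∈ U, ∀ w : En n, ∀ r : ℝ, 0 < r →
    (∀ ζ : ℂ, ‖ζ‖ ≤ r → z + ζ • w ∈ U) →
    u z ≤ eint thetaM (fun θ => u (z + (circleMap 0 r θ) • w))

/-- `μ` is a Jensen measure on `X` with barycenter `z`:  a Borel probability measure
supported on `X` such that `u z ≤ ∫ u dμ` for every function `u` continuous and
plurisubharmonic on some open neighborhood of `X`. -/
def IsJensen {n : ℕ} (X : Set (En n)) (z : En n) (μ : Measure (En n)) : Prop :=
  IsProbabilityMeasure μ ∧ μ Xᶜ = 0 ∧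
  ∀ U : Set (En n), IsOpen U → X ⊆ U →
    ∀ u : En n → EReal, ContinuousOn u U → PshOnE u U → u z ≤ eint μ u

/-- `u : X → [-∞, ∞)` is plurisubharmonic on the compact set `X` : it is upper
semicontinuous on `X`, `< ⊤` on `X`, and satisfies the subaveraging inequality with respect
to all Jensen measures on `X`. -/
def PSHe {n : ℕ} (X : Set (En n)) (u : En n → EReal) : Prop :=
  UpperSemicontinuousOn u X ∧ (∀ z ∈ X, u z < ⊤) ∧
  ∀ z ∈ X, ∀ μ : Measure (En n), IsJensen X z μ → u z ≤ eint μ u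

/-- `PSH^c(X)`: continuous plurisubharmonic functions on `X`. -/
def PSHce {n : ℕ} (X : Set (En n)) (u : En n → EReal) : Prop :=
  PSHe X u ∧ ContinuousOn u X

/-- Real-valued continuous plurisubharmonic functions on `X`. -/
def PSHcR {n : ℕ} (X : Set (En n)) (u : En n → ℝ) : Prop :=
  ContinuousOn u X ∧ PSHe X (fun x => (u x : EReal))

/-- `O_X`: the set of points `z ∈ X` whose only Jensen measure is `δ_z`. -/
def Oset {n : ℕ} (X : Set (En n)) : Set (En n) :=
  {z | z ∈ X ∧ ∀ μ : Measure (En n), IsJensen X z μ → μ = Measure.dirac z}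

/-- The potential boundary `B_X`, the closure of `O_X`. -/
def Bset {n : ℕ} (X : Set (En n)) : Set (En n) := closure (Oset X)

/-- `J^b_z(X)`: Jensen measures with barycenter `z` supported on `B_X`. -/
def IsJensenB {n : ℕ} (X : Set (En n)) (z : En n) (μ : Measure (En n)) : Prop :=
  IsJensen X z μ ∧ μ (Bset X)ᶜ = 0

/-- `ν` is subordinated to `μ` : `μ(u) ≥ ν(u)` for all `u ∈ PSH^c(X)`. -/
def Subord {n : ℕ} (X : Set (En n)) (μ ν : Measure (En n)) : Prop :=
  ∀ u : En n → EReal, PSHce X u → eint ν u ≤ eint μ u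

/-- Subharmonic functions with values in `[-∞, ∞)` on an open set `U ⊆ ℂ`. -/
def SubharmOn (u : ℂ → EReal) (U : Set ℂ) : Prop :=
  UpperSemicontinuousOn u U ∧ (∀ z ∈ U, u z < ⊤) ∧
  ∀ z ∈ U, ∀ r : ℝ, 0 < r → closedBall z r ⊆ U →
    u z ≤ eint thetaM (fun θ => u (circleMap z r θ))

/-- Harmonic (real-valued) functions on an open set `U ⊆ ℂ`: continuous functions
satisfying the mean-value equality. -/
def HarmOn (h : ℂ → ℝ) (U : Set ℂ) : Prop :=
  ContinuousOn h U ∧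
  ∀ z ∈ U, ∀ r : ℝ, 0 < r → closedBall z r ⊆ U →
    h z = (2 * Real.pi)⁻¹ * ∫ θ in (0 : ℝ)..(2 * Real.pi), h (circleMap z r θ)

/-- Superharmonic (real-valued) functions on an open set `U ⊆ ℂ`. -/
def SuperharmOn (v : ℂ → ℝ) (U : Set ℂ) : Prop :=
  LowerSemicontinuousOn v U ∧
  ∀ z ∈ U, ∀ r : ℝ, 0 < r → closedBall z r ⊆ U →
    (2 * Real.pi)⁻¹ * (∫ θ in (0 : ℝ)..(2 * Real.pi), v (circleMap z r θ)) ≤ v z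

/-- The infimum of all positive superharmonic functions on the unit disk, extending
continuously to the closed disk and `≥ 1` on `A`, evaluated at `z`. -/
def hmPre (A : Set ℂ) (z : ℂ) : ℝ :=
  sInf {t : ℝ | ∃ v : ℂ → ℝ, SuperharmOn v (ball 0 1) ∧ (∀ w ∈ ball (0 : ℂ) 1, 0 < v w) ∧
    ContinuousOn v (closedBall 0 1) ∧ (∀ w ∈ A, 1 ≤ v w) ∧ t = v z}

/-- The harmonic measure `ω(z, A, 𝔻)` of `A` with respect to the unit disk. -/
def hm (z : ℂ) (A : Set ℂ) : ℝ := Filter.liminf (fun w => hmPre A w) (𝓝 z)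

open Classical in
/-- The radial limit of a map `f` at the boundary point `ζ` of the unit circle
(junk value `0` if the radial limit does not exist). -/
def bval {n : ℕ} (f : ℂ → En n) (ζ : ℂ) : En n :=
  if h : ∃ l : En n, Tendsto (fun r : ℝ => f ((r : ℂ) * ζ)) (𝓝[<] (1 : ℝ)) (𝓝 l)
  then h.choose else 0

open Classical in
/-- The radial limit of an `EReal`-valued function on the disk at the boundary point `ζ`. -/
def bvalE (g : ℂ → EReal) (ζ : ℂ) : EReal :=
  if h : ∃ l : EReal, Tendsto (fun r : ℝ => g ((r : ℂ) * ζ)) (𝓝[<] (1 : ℝ)) (𝓝 l)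
  then h.choose else 0

/-- `μ_f`: the push-forward of the normalized arclength measure on the unit circle under the
radial boundary values of `f`. -/
def bmeas {n : ℕ} (f : ℂ → En n) : Measure (En n) :=
  thetaM.map (fun θ => bval f (circleMap 0 1 θ))

/-- Weak-* convergence of a sequence of measures on `ℂⁿ`. -/
def WeakConv {n : ℕ} (μs : ℕ → Measure (En n)) (μ : Measure (En n)) : Prop :=
  ∀ φ : BoundedContinuousFunction (En n) ℝ,
    Tendsto (fun j => ∫ x, φ x ∂(μs j)) atTop (𝓝 (∫ x, φ x ∂μ))

/-- The cluster set `cl L` of a sequence of maps of the unit disk into `ℂⁿ`. -/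
def clusterSet {n : ℕ} (f : ℕ → ℂ → En n) : Set (En n) :=
  {z | ∀ r : ℝ, 0 < r → ∀ N : ℕ, ∃ j, N ≤ j ∧ ∃ ζ ∈ ball (0 : ℂ) 1, f j ζ ∈ ball z r}

/-- A point `z` is totally essential for the sequence `f` if for every open set `V ∋ z` the
harmonic measures at `0` of `f j ⁻¹' V` stay bounded away from `0`. -/
def TotallyEssential {n : ℕ} (f : ℕ → ℂ → En n) (z : En n) : Prop :=
  ∀ V : Set (En n), IsOpen V → z ∈ V →
    0 < Filter.atTop.liminf (fun j => hm 0 ((f j ⁻¹' V) ∩ ball 0 1))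

/-- A totally perfect sequence `L` of holomorphic maps of the unit disk into `ℂⁿ`: a
uniformly bounded sequence of holomorphic maps which is weak-* converging (with limit measure
`μ_L` and center `z_L`) and all of whose cluster points are totally essential. -/
structure PerfectSeq (n : ℕ) where
  f : ℕ → ℂ → En n
  holo : ∀ j, DifferentiableOn ℂ (f j) (ball 0 1)
  bdd : ∃ C : ℝ, ∀ j, ∀ ζ ∈ ball (0 : ℂ) 1, ‖f j ζ‖ ≤ C
  μL : Measure (En n)
  conv : WeakConv (fun j => bmeas (f j)) μL
  zL : En n
  center : Tendsto (fun j => f j 0) atTop (𝓝 zL)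
  ess : ∀ z ∈ clusterSet f, TotallyEssential f z

/-- `J_z^s(L)`: the measures obtained as weak-* limits of `μ_{f_{j_k} ∘ g_k}` for subsequences
`{j_k}` and holomorphic maps `g_k : 𝔻 → 𝔻` with `f_{j_k}(g_k(0)) → z`. -/
def JsSet {n : ℕ} (L : PerfectSeq n) (z : En n) : Set (Measure (En n)) :=
  {μ | ∃ jk : ℕ → ℕ, StrictMono jk ∧ ∃ g : ℕ → ℂ → ℂ,
    (∀ k, DifferentiableOn ℂ (g k) (ball 0 1) ∧ MapsTo (g k) (ball 0 1) (ball 0 1)) ∧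
    WeakConv (fun k => bmeas ((L.f (jk k)) ∘ (g k))) μ ∧
    Tendsto (fun k => L.f (jk k) (g k 0)) atTop (𝓝 z)}

/-- `J_z(L)`: the convex hull of `J_z^s(L)`. -/
def JLSet {n : ℕ} (L : PerfectSeq n) (z : En n) : Set (Measure (En n)) :=
  {μ | ∃ (m : ℕ) (w : Fin m → ℝ) (ν : Fin m → Measure (En n)),
    (∀ i, 0 ≤ w i) ∧ (∑ i, w i = 1) ∧ (∀ i, ν i ∈ JsSet L z) ∧
    μ = ∑ i, (ENNReal.ofReal (w i)) • ν i}

/-- `u` is harmonic on the totally perfect sequence `L`. -/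
def HarmonicOnL {n : ℕ} (L : PerfectSeq n) (u : En n → EReal) : Prop :=
  PSHce (clusterSet L.f) u ∧
  ∀ z ∈ clusterSet L.f, ∀ μ ∈ JLSet L z, eint μ u = u z

/-- `PSH^w(X)`: weakly plurisubharmonic functions, the upper envelopes of nonempty families
of continuous plurisubharmonic functions on `X`. -/
def PSHw {n : ℕ} (X : Set (En n)) (u : En n → EReal) : Prop :=
  ∃ F : Set (En n → EReal), F.Nonempty ∧ (∀ v ∈ F, PSHce X v) ∧
    ∀ x ∈ X, u x = ⨆ v ∈ F, v x

/-- `u` is maximal on `X ∖ Z`: for every relatively open `V ⊆ X ∖ Z` and every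
`v ∈ PSH^c(closure V)`, if `v ≤ u` on the relative boundary of `V` in `X` then `v ≤ u`
on `closure V`. -/
def MaximalOn {n : ℕ} (X Z : Set (En n)) (u : En n → EReal) : Prop :=
  ∀ W : Set (En n), IsOpen W → X ∩ W ⊆ X \ Z →
    ∀ v : En n → EReal, PSHce (closure (X ∩ W)) v →
      (∀ x ∈ closure (X ∩ W) \ (X ∩ W), v x ≤ u x) →
      ∀ x ∈ closure (X ∩ W), v x ≤ u x

/-- Pluriharmonic continuous real-valued functions on `X`. -/
def Pluriharm {n : ℕ} (X : Set (En n)) (h : En n → ℝ) : Prop :=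
  ContinuousOn h X ∧
  ∀ z ∈ X, ∀ μ : Measure (En n), IsJensen X z μ → (h z : EReal) = eint μ (fun x => (h x : EReal))

/-- `X` is a Poisson set: every continuous real-valued function on `B_X` extends to a
pluriharmonic function on `X`. -/
def PoissonSet {n : ℕ} (X : Set (En n)) : Prop :=
  ∀ φ : En n → ℝ, ContinuousOn φ (Bset X) →
    ∃ h : En n → ℝ, Pluriharm X h ∧ ∀ w ∈ Bset X, h w = φ w

end

/-- Continuous functions on a circle centred at `0` are uniformly approximated by real parts of
entire functions. -/
theorem exists_entire_re_approx {r : ℝ} (hr : 0 < r) {f : ℂ → ℝ}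
    (hf : ContinuousOn f (sphere 0 r)) {ε : ℝ} (hε : 0 < ε) :
    ∃ g : ℂ → ℂ, Differentiable ℂ g ∧ ∀ ζ ∈ sphere (0 : ℂ) r, |f ζ - (g ζ).re| < ε := by
  have : Fact (0 < 2 * Real.pi) := ⟨by positivity⟩
  have hmem : ∀ x : AddCircle (2 * Real.pi), (r : ℂ) * (x.toCircle : ℂ) ∈ sphere (0 : ℂ) r := by
    intro x
    rw [mem_sphere_zero_iff_norm, norm_mul, Circle.norm_coe, Complex.norm_real, Real.norm_eq_abs,
      abs_of_pos hr, mul_one]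
  have hcont : Continuous fun x : AddCircle (2 * Real.pi) =>
      ((f ((r : ℂ) * (x.toCircle : ℂ)) : ℝ) : ℂ) := by
    refine Complex.continuous_ofReal.comp (hf.comp_continuous ?_ hmem)
    exact continuous_const.mul (continuous_subtype_val.comp AddCircle.continuous_toCircle)
  let F : C(AddCircle (2 * Real.pi), ℂ) := ⟨_, hcont⟩
  have hspan : ∀ q ∈ Submodule.span ℂ (range (@fourier (2 * Real.pi))),
      ∃ g₁ g₂ : ℂ → ℂ, Differentiable ℂ g₁ ∧ Differentiable ℂ g₂ ∧
        ∀ x : AddCircle (2 * Real.pi), q x =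
          g₁ (x.toCircle : ℂ) + (starRingEnd ℂ) (g₂ (x.toCircle : ℂ)) := by
    intro q hq
    induction hq using Submodule.span_induction with
    | mem q h =>
      obtain ⟨k, rfl⟩ := h
      obtain ⟨m, rfl | rfl⟩ := k.eq_nat_or_neg
      · refine ⟨fun z => z ^ m, fun _ => 0, by fun_prop, by fun_prop, fun x => ?_⟩
        simp [fourier_apply, AddCircle.toCircle_nsmul]
      · refine ⟨fun _ => 0, fun z => z ^ m, by fun_prop, by fun_prop, fun x => ?_⟩
        rw [fourier_neg]
        simp [fourier_apply, AddCircle.toCircle_nsmul]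
    | zero => exact ⟨fun _ => 0, fun _ => 0, by fun_prop, by fun_prop, fun x => by simp⟩
    | add p q _ _ hp hq =>
      obtain ⟨a, b, ha, hb, hab⟩ := hp
      obtain ⟨c, d, hc, hd, hcd⟩ := hq
      refine ⟨a + c, b + d, ha.add hc, hb.add hd, fun x => ?_⟩
      simp only [ContinuousMap.add_apply, hab, hcd, Pi.add_apply, map_add]
      ring
    | smul c q _ hq =>
      obtain ⟨a, b, ha, hb, hab⟩ := hq
      refine ⟨fun z => c * a z, fun z => (starRingEnd ℂ) c * b z, ha.const_mul _,
        hb.const_mul _, fun x => ?_⟩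
      simp only [ContinuousMap.smul_apply, hab, smul_eq_mul, map_mul, Complex.conj_conj]
      ring
  have hF : F ∈ (Submodule.span ℂ (range (@fourier (2 * Real.pi)))).topologicalClosure := by
    rw [span_fourier_closure_eq_top]; trivial
  obtain ⟨q, hq, hdist⟩ := Metric.mem_closure_iff.1 hF ε hε
  obtain ⟨g₁, g₂, h₁, h₂, hq'⟩ := hspan q hq
  refine ⟨fun z => g₁ (z / r) + g₂ (z / r), ?_, fun ζ hζ => ?_⟩
  · exact (h₁.comp (by fun_prop)).add (h₂.comp (by fun_prop))
  · have hr' : (r : ℂ) ≠ 0 := by exact_mod_cast hr.ne'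
    have hn : ζ / r ∈ Submonoid.unitSphere ℂ := by
      rw [Submonoid.unitSphere]
      simp only [mem_sphere_zero_iff_norm] at hζ
      simp [hζ, abs_of_pos hr, hr.ne']
    obtain ⟨x, hx⟩ := (AddCircle.homeomorphCircle Real.two_pi_pos.ne').surjective
      (⟨ζ / r, hn⟩ : Circle)
    have hx' : (x.toCircle : ℂ) = ζ / r := by
      have := congrArg (fun c : Circle => (c : ℂ)) hx
      simpa [AddCircle.homeomorphCircle_apply] using this
    have h1 : ‖F x - q x‖ < ε := by
      have := (ContinuousMap.dist_apply_le_dist (f := F) (g := q) x).trans_lt hdist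
      rwa [dist_eq_norm] at this
    have h2 : F x = ((f ζ : ℝ) : ℂ) := by
      change ((f ((r : ℂ) * (x.toCircle : ℂ)) : ℝ) : ℂ) = _
      rw [hx', mul_div_cancel₀ _ hr']
    rw [h2, hq' x, hx'] at h1
    refine lt_of_le_of_lt (le_trans (le_of_eq ?_) (Complex.abs_re_le_norm _)) h1
    simp

theorem circleAverage_re_of_differentiable {g : ℂ → ℂ} (hg : Differentiable ℂ g) (c : ℂ)
    (r : ℝ) : Real.circleAverage (fun ζ => (g ζ).re) c r = (g c).re := by
  have h1 := Complex.reCLM.circleAverage_comp_comm (f := g) (c := c) (R := r)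
    (by
      have : Continuous g := hg.continuous
      exact (this.comp (continuous_circleMap c r)).intervalIntegrable _ _)
  rw [hg.diffContOnCl.circleAverage] at h1
  exact h1

/-- The local sub-mean-value property of a continuous function on a closed disc implies the
sub-mean-value inequality for the whole disc. -/
theorem le_circleAverage_of_local {r : ℝ} (hr : 0 < r) {f : ℂ → ℝ}
    (hf : ContinuousOn f (closedBall 0 r))
    (hloc : ∀ ζ ∈ ball (0 : ℂ) r, ∃ ρ₀ > 0, ∀ ρ, 0 < ρ → ρ < ρ₀ →
      f ζ ≤ Real.circleAverage f ζ ρ) :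
    f 0 ≤ Real.circleAverage f 0 r := by
  refine le_of_forall_pos_le_add fun ε hε => ?_
  obtain ⟨g, hg, happ⟩ := exists_entire_re_approx hr (hf.mono sphere_subset_closedBall)
    (half_pos hε)
  have hgc : Continuous fun ζ => (g ζ).re := Complex.continuous_re.comp hg.continuous
  have hmax : ∀ ζ ∈ closedBall (0 : ℂ) r, f ζ - (g ζ).re ≤ ε / 2 := by
    by_contra! hcon
    obtain ⟨ζ₁, hζ₁, hlt⟩ := hcon
    have hd : ContinuousOn (fun ζ => f ζ - (g ζ).re) (closedBall 0 r) := hf.sub hgc.continuousOn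
    obtain ⟨ζ₂, hζ₂, hM⟩ := (isCompact_closedBall (0 : ℂ) r).exists_isMaxOn ⟨ζ₁, hζ₁⟩ hd
    set M := f ζ₂ - (g ζ₂).re with hMdef
    have hMε : ε / 2 < M := hlt.trans_le (hM hζ₁)
    have hAc : IsCompact (closedBall (0 : ℂ) r ∩ (fun ζ => f ζ - (g ζ).re) ⁻¹' {M}) :=
      (isCompact_closedBall (0 : ℂ) r).of_isClosed_subset
        (hd.preimage_isClosed_of_isClosed isClosed_closedBall isClosed_singleton)
        inter_subset_left
    obtain ⟨ζ₀, ⟨hζ₀, hζ₀M⟩, hfar⟩ := hAc.exists_isMaxOn ⟨ζ₂, hζ₂, rfl⟩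
      (continuous_norm.continuousOn)
    have hζ₀M : f ζ₀ - (g ζ₀).re = M := hζ₀M
    have hball : ζ₀ ∈ ball (0 : ℂ) r := by
      rcases (mem_closedBall_zero_iff.1 hζ₀).lt_or_eq with h | h
      · exact mem_ball_zero_iff.2 h
      · have := happ ζ₀ (mem_sphere_zero_iff_norm.2 h)
        rw [hζ₀M] at this
        linarith [le_abs_self M]
    obtain ⟨ρ₀, hρ₀, hsub⟩ := hloc ζ₀ hball
    set ρ := min (ρ₀ / 2) ((r - ‖ζ₀‖) / 2) with hρdef
    have hζ₀r : ‖ζ₀‖ < r := mem_ball_zero_iff.1 hball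
    have hρ : 0 < ρ := lt_min (by linarith) (by linarith)
    have hρ1 : ρ < ρ₀ := (min_le_left _ _).trans_lt (by linarith)
    have hρ2 : ρ ≤ (r - ‖ζ₀‖) / 2 := min_le_right _ _
    have hsph : closedBall ζ₀ ρ ⊆ closedBall 0 r := by
      refine closedBall_subset_closedBall' ?_
      rw [dist_zero_right]; linarith
    have hsph' : sphere ζ₀ ρ ⊆ closedBall 0 r := sphere_subset_closedBall.trans hsph
    have hfi : CircleIntegrable f ζ₀ ρ := (hf.mono hsph').circleIntegrable hρ.le
    have hgi : CircleIntegrable (fun ζ => (g ζ).re) ζ₀ ρ :=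
      hgc.continuousOn.circleIntegrable hρ.le
    have havg : M ≤ Real.circleAverage (fun ζ => f ζ - (g ζ).re) ζ₀ ρ := by
      rw [Real.circleAverage_fun_sub hfi hgi, circleAverage_re_of_differentiable hg, ← hζ₀M]
      linarith [hsub ρ hρ hρ1]
    -- the point of the small circle farthest from the origin
    obtain ⟨e, he, heq⟩ : ∃ e : ℂ, ‖e‖ = 1 ∧ ζ₀ = ‖ζ₀‖ * e := by
      by_cases h0 : ζ₀ = 0
      · exact ⟨1, by simp, by simp [h0]⟩
      · have : (‖ζ₀‖ : ℂ) ≠ 0 := by simpa using h0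
        exact ⟨ζ₀ / ‖ζ₀‖, by simp [h0], by field_simp⟩
    set ζ₃ := ζ₀ + ρ * e with hζ₃
    have hζ₃s : ζ₃ ∈ sphere ζ₀ ρ := by
      simp [hζ₃, he, abs_of_pos hρ]
    have hζ₃n : ‖ζ₃‖ = ‖ζ₀‖ + ρ := by
      have : ζ₃ = ((‖ζ₀‖ + ρ : ℝ) : ℂ) * e := by
        rw [hζ₃]; nth_rewrite 1 [heq]; push_cast; ring
      rw [this, norm_mul, he, mul_one, Complex.norm_real, Real.norm_eq_abs,
        abs_of_nonneg (by positivity)]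
    have hlt3 : f ζ₃ - (g ζ₃).re < M := by
      refine lt_of_le_of_ne (hM (hsph' hζ₃s)) fun h => ?_
      have := hfar (show ζ₃ ∈ _ from ⟨hsph' hζ₃s, h⟩)
      change ‖ζ₃‖ ≤ ‖ζ₀‖ at this
      linarith
    obtain ⟨θ, hθ⟩ : ζ₃ ∈ range (circleMap ζ₀ ρ) := by
      rw [range_circleMap, abs_of_pos hρ]; exact hζ₃s
    obtain ⟨θ', hθ', hθe⟩ : ∃ θ' ∈ Ico 0 (2 * Real.pi), circleMap ζ₀ ρ θ' = ζ₃ := by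
      obtain ⟨y, hy, hye⟩ := (periodic_circleMap ζ₀ ρ).exists_mem_Ico₀ Real.two_pi_pos θ
      exact ⟨y, hy, hye ▸ hθ⟩
    have hcM : Continuous fun θ => f (circleMap ζ₀ ρ θ) - (g (circleMap ζ₀ ρ θ)).re :=
      (hd.mono hsph').comp_continuous (continuous_circleMap ζ₀ ρ)
        (fun θ => circleMap_mem_sphere _ hρ.le _)
    have h_int : ∫ θ in (0 : ℝ)..(2 * Real.pi),
        (f (circleMap ζ₀ ρ θ) - (g (circleMap ζ₀ ρ θ)).re) < ∫ θ in (0 : ℝ)..(2 * Real.pi), M := by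
      refine intervalIntegral.integral_lt_integral_of_continuousOn_of_le_of_exists_lt
        Real.two_pi_pos hcM.continuousOn continuousOn_const
        (fun θ _ => hM (hsph' (circleMap_mem_sphere _ hρ.le _)))
        ⟨θ', Ico_subset_Icc_self hθ', by rw [hθe]; exact hlt3⟩
    have : Real.circleAverage (fun ζ => f ζ - (g ζ).re) ζ₀ ρ < M := by
      rw [Real.circleAverage_def, smul_eq_mul, inv_mul_lt_iff₀ Real.two_pi_pos]
      simpa using h_int
    linarith
  have h0 := hmax 0 (mem_closedBall_self hr.le)
  have hfi : CircleIntegrable f 0 r := (hf.mono sphere_subset_closedBall).circleIntegrable hr.le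
  have hle : Real.circleAverage (fun ζ => (g ζ).re) 0 r ≤
      Real.circleAverage (fun ζ => f ζ + ε / 2) 0 r := by
    refine Real.circleAverage_mono (hgc.continuousOn.circleIntegrable hr.le)
      (hfi.add (continuousOn_const.circleIntegrable hr.le)) fun x hx => ?_
    rw [abs_of_pos hr] at hx
    have := abs_lt.1 (happ x hx)
    linarith
  rw [circleAverage_re_of_differentiable hg, Real.circleAverage_fun_add hfi
    (continuousOn_const.circleIntegrable hr.le), Real.circleAverage_const] at hle
  linarith

theorem epos_coe (x : ℝ) : epos (x : EReal) = ENNReal.ofReal x := by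
  simp [epos]

theorem epos_mono : Monotone epos := by
  intro x y hxy
  induction y with
  | top => simp [epos]
  | bot => rw [le_bot_iff.1 hxy]
  | coe y =>
    induction x with
    | top => exact absurd hxy (by simp)
    | bot => simp [epos]
    | coe x =>
      rw [epos_coe, epos_coe]
      exact ENNReal.ofReal_le_ofReal (EReal.coe_le_coe_iff.1 hxy)

theorem eint_mono_ae {α : Type*} [MeasurableSpace α] {μ : Measure α} {u v : α → EReal}
    (h : ∀ᵐ x ∂μ, u x ≤ v x) : eint μ u ≤ eint μ v := by
  refine EReal.sub_le_sub ?_ ?_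
  · exact EReal.coe_ennreal_le_coe_ennreal_iff.2
      (lintegral_mono_ae (h.mono fun x hx => epos_mono hx))
  · exact EReal.coe_ennreal_le_coe_ennreal_iff.2
      (lintegral_mono_ae (h.mono fun x hx => epos_mono (EReal.neg_le_neg_iff.2 hx)))

theorem eint_congr_ae {α : Type*} [MeasurableSpace α] {μ : Measure α} {u v : α → EReal}
    (h : ∀ᵐ x ∂μ, u x = v x) : eint μ u = eint μ v :=
  le_antisymm (eint_mono_ae (h.mono fun _ hx => hx.le)) (eint_mono_ae (h.mono fun _ hx => hx.ge))

theorem eint_coe {α : Type*} [MeasurableSpace α] {μ : Measure α} {f : α → ℝ}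
    (hf : Integrable f μ) : eint μ (fun x => (f x : EReal)) = ((∫ x, f x ∂μ : ℝ) : EReal) := by
  have hpos : ∫⁻ x, ENNReal.ofReal (f x) ∂μ ≠ ⊤ := hf.lintegral_lt_top.ne
  have hneg : ∫⁻ x, ENNReal.ofReal (-f x) ∂μ ≠ ⊤ := hf.neg.lintegral_lt_top.ne
  rw [integral_eq_lintegral_pos_part_sub_lintegral_neg_part hf, EReal.coe_sub, eint]
  simp only [← EReal.coe_neg, epos_coe]
  rw [EReal.coe_ennreal_toReal hpos, EReal.coe_ennreal_toReal hneg]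

theorem eint_thetaM_circleMap {g : ℂ → ℝ} {c : ℂ} {r : ℝ}
    (hg : ContinuousOn g (sphere c |r|)) :
    eint thetaM (fun θ => (g (circleMap c r θ) : EReal)) =
      ((Real.circleAverage g c r : ℝ) : EReal) := by
  have hc : Continuous fun θ => g (circleMap c r θ) :=
    hg.comp_continuous (continuous_circleMap c r) fun θ => circleMap_mem_sphere' c r θ
  have hi : IntegrableOn (fun θ => g (circleMap c r θ)) (Ico 0 (2 * Real.pi)) :=
    (hc.integrableOn_Icc (μ := volume)).mono_set Ico_subset_Icc_self
  rw [eint_coe]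
  · rw [thetaM, integral_smul_measure, ENNReal.toReal_ofReal (by positivity),
      Real.circleAverage_def, integral_Ico_eq_integral_Ioc,
      intervalIntegral.integral_of_le Real.two_pi_pos.le]
  · exact Integrable.smul_measure hi ENNReal.ofReal_ne_top

/-- A real-valued continuous function satisfying the sub-mean-value inequality on all discs
contained in `U`. -/
def SubMeanOn {n : ℕ} (f : En n → ℝ) (U : Set (En n)) : Prop :=
  ContinuousOn f U ∧ ∀ z ∈ U, ∀ w : En n, ∀ r : ℝ, 0 < r →
    (∀ ζ : ℂ, ‖ζ‖ ≤ r → z + ζ • w ∈ U) →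
    f z ≤ Real.circleAverage (fun ζ => f (z + ζ • w)) 0 r

theorem continuousOn_disc_comp {n : ℕ} {f : En n → ℝ} {U : Set (En n)} (hf : ContinuousOn f U)
    {z w : En n} {r : ℝ} (h : ∀ ζ : ℂ, ‖ζ‖ ≤ r → z + ζ • w ∈ U) :
    ContinuousOn (fun ζ : ℂ => f (z + ζ • w)) (closedBall 0 r) :=
  hf.comp (by fun_prop) fun ζ hζ => h ζ (mem_closedBall_zero_iff.1 hζ)

theorem circleIntegrable_disc_comp {n : ℕ} {f : En n → ℝ} {U : Set (En n)}
    (hf : ContinuousOn f U) {z w : En n} {r : ℝ} (hr : 0 < r)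
    (h : ∀ ζ : ℂ, ‖ζ‖ ≤ r → z + ζ • w ∈ U) :
    CircleIntegrable (fun ζ : ℂ => f (z + ζ • w)) 0 r :=
  ((continuousOn_disc_comp hf h).mono sphere_subset_closedBall).circleIntegrable hr.le

namespace SubMeanOn

variable {n : ℕ} {f g : En n → ℝ} {U V : Set (En n)}

theorem pshOnE (hf : SubMeanOn f U) : PshOnE (fun x => (f x : EReal)) U := by
  refine ⟨?_, fun z _ => EReal.coe_lt_top _, fun z hz w r hr hd => ?_⟩
  · exact (continuous_coe_real_ereal.comp_continuousOn hf.1).upperSemicontinuousOn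
  · rw [eint_thetaM_circleMap (g := fun ζ => f (z + ζ • w))]
    · exact EReal.coe_le_coe_iff.2 (hf.2 z hz w r hr hd)
    · rw [abs_of_pos hr]
      exact (continuousOn_disc_comp hf.1 hd).mono sphere_subset_closedBall

theorem mono (hf : SubMeanOn f V) (h : U ⊆ V) : SubMeanOn f U :=
  ⟨hf.1.mono h, fun z hz w r hr hd => hf.2 z (h hz) w r hr fun ζ hζ => h (hd ζ hζ)⟩

theorem congr (hf : SubMeanOn f U) (h : ∀ x ∈ U, g x = f x) : SubMeanOn g U := by
  refine ⟨hf.1.congr h, fun z hz w r hr hd => ?_⟩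
  rw [h z hz, Real.circleAverage_congr_sphere (f₂ := fun ζ => f (z + ζ • w))]
  · exact hf.2 z hz w r hr hd
  · intro ζ hζ
    rw [abs_of_pos hr, mem_sphere_zero_iff_norm] at hζ
    exact h _ (hd ζ hζ.le)

theorem const (c : ℝ) : SubMeanOn (fun _ => c) U :=
  ⟨continuousOn_const, fun z _ w r _ _ => by rw [Real.circleAverage_const]⟩

theorem add (hf : SubMeanOn f U) (hg : SubMeanOn g U) : SubMeanOn (fun x => f x + g x) U := by
  refine ⟨hf.1.add hg.1, fun z hz w r hr hd => ?_⟩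
  rw [Real.circleAverage_fun_add (circleIntegrable_disc_comp hf.1 hr hd)
    (circleIntegrable_disc_comp hg.1 hr hd)]
  exact add_le_add (hf.2 z hz w r hr hd) (hg.2 z hz w r hr hd)

theorem const_mul (hf : SubMeanOn f U) {c : ℝ} (hc : 0 ≤ c) :
    SubMeanOn (fun x => c * f x) U := by
  refine ⟨continuousOn_const.mul hf.1, fun z hz w r hr hd => ?_⟩
  have := Real.circleAverage_fun_smul (a := c) (f := fun ζ => f (z + ζ • w)) (c := 0) (R := r)
  simp only [smul_eq_mul] at this
  rw [this]
  exact mul_le_mul_of_nonneg_left (hf.2 z hz w r hr hd) hc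

theorem max (hf : SubMeanOn f U) (hg : SubMeanOn g U) :
    SubMeanOn (fun x => Max.max (f x) (g x)) U := by
  have hc : ContinuousOn (fun x => Max.max (f x) (g x)) U := hf.1.sup hg.1
  refine ⟨hc, fun z hz w r hr hd => max_le ?_ ?_⟩
  · exact (hf.2 z hz w r hr hd).trans (Real.circleAverage_mono
      (circleIntegrable_disc_comp hf.1 hr hd) (circleIntegrable_disc_comp hc hr hd)
      fun _ _ => le_max_left _ _)
  · exact (hg.2 z hz w r hr hd).trans (Real.circleAverage_mono
      (circleIntegrable_disc_comp hg.1 hr hd) (circleIntegrable_disc_comp hc hr hd)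
      fun _ _ => le_max_right _ _)

/-- Real parts of complex linear functionals have the mean value property. -/
theorem re_linear (L : En n →L[ℂ] ℂ) : SubMeanOn (fun x => (L x).re) U := by
  refine ⟨by fun_prop, fun z _ w r _ _ => ?_⟩
  have hd : Differentiable ℂ fun ζ : ℂ => L (z + ζ • w) := by fun_prop
  rw [circleAverage_re_of_differentiable hd]
  simp

/-- The sub-mean-value property is local. -/
theorem of_local (h : ∀ x ∈ U, ∃ O, IsOpen O ∧ x ∈ O ∧ SubMeanOn f O) : SubMeanOn f U := by
  have hc : ContinuousOn f U := fun x hx => by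
    obtain ⟨O, hO, hxO, hf⟩ := h x hx
    exact (hf.1.continuousAt (hO.mem_nhds hxO)).continuousWithinAt
  refine ⟨hc, fun z hz w r hr hd => ?_⟩
  have := le_circleAverage_of_local hr (continuousOn_disc_comp hc hd) fun ζ hζ => ?_
  · simpa using this
  · obtain ⟨O, hO, hxO, hf⟩ := h _ (hd ζ (mem_ball_zero_iff.1 hζ).le)
    have hpre : IsOpen ((fun ζ : ℂ => z + ζ • w) ⁻¹' O) := hO.preimage (by fun_prop)
    obtain ⟨ρ₀, hρ₀, hball⟩ := Metric.isOpen_iff.1 hpre ζ hxO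
    refine ⟨ρ₀, hρ₀, fun ρ hρ hlt => ?_⟩
    have h1 := hf.2 _ hxO w ρ hρ fun ξ hξ => by
      have : ζ + ξ ∈ ball ζ ρ₀ := by simpa using hξ.trans_lt hlt
      have := hball this
      simp only [mem_preimage, add_smul, ← add_assoc] at this
      exact this
    refine h1.trans (le_of_eq ?_)
    rw [← Real.circleAverage_map_add_const (c := ζ)]
    congr 1
    ext ξ
    rw [add_smul, add_assoc, add_comm (ζ • w)]

open Classical in
/-- Gluing: `max f g` on `A` and `g` elsewhere. -/
theorem glue {A P Q : Set (En n)} (hA : IsOpen A) (hP : IsOpen P) (hQ : IsOpen Q)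
    (hAQ : Disjoint A Q) (hf : SubMeanOn f (A ∪ P)) (hg : SubMeanOn g (A ∪ P ∪ Q))
    (hlt : ∀ x ∈ P, f x ≤ g x) :
    SubMeanOn (fun x => if x ∈ A then Max.max (f x) (g x) else g x) (A ∪ P ∪ Q) := by
  refine of_local fun x hx => ?_
  have hPQ : SubMeanOn (fun x => if x ∈ A then Max.max (f x) (g x) else g x) (P ∪ Q) := by
    refine (hg.mono ?_).congr fun y hy => ?_
    · rw [union_assoc]; exact subset_union_right
    · split_ifs with hyA
      · rcases hy with hy | hy
        · exact max_eq_right (hlt y hy)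
        · exact absurd hy (disjoint_left.1 hAQ hyA)
      · rfl
  have hAP : SubMeanOn (fun x => if x ∈ A then Max.max (f x) (g x) else g x) (A ∪ P) := by
    refine (hf.max (hg.mono subset_union_left)).congr fun y hy => ?_
    split_ifs with hyA
    · rfl
    · exact (max_eq_right (hlt y (hy.resolve_left hyA))).symm
  rcases hx with hx | hx
  · exact ⟨_, hA.union hP, hx, hAP⟩
  · exact ⟨_, hP.union hQ, Or.inr hx, hPQ⟩

end SubMeanOn

theorem coe_toReal_max {x : EReal} (hx : x < ⊤) (N : ℝ) :
    (((max x (N : EReal)).toReal : ℝ) : EReal) = max x (N : EReal) :=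
  EReal.coe_toReal (max_lt hx (EReal.coe_lt_top N)).ne
    ((EReal.bot_lt_coe N).trans_le (le_max_right _ _)).ne'

theorem ContinuousOn.toReal_max {α : Type*} [TopologicalSpace α] {u : α → EReal} {U : Set α}
    (hu : ContinuousOn u U) (htop : ∀ z ∈ U, u z < ⊤) (N : ℝ) :
    ContinuousOn (fun x => (max (u x) (N : EReal)).toReal) U := by
  have h : ContinuousOn (fun x => max (u x) (N : EReal)) U := hu.sup continuousOn_const
  refine EReal.continuousOn_toReal.comp h fun x hx => ?_
  simp only [mem_compl_iff, mem_insert_iff, mem_singleton_iff, not_or]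
  exact ⟨((EReal.bot_lt_coe N).trans_le (le_max_right _ _)).ne',
    (max_lt (htop x hx) (EReal.coe_lt_top N)).ne⟩

/-- Truncating a continuous plurisubharmonic function from below gives a real-valued function
with the sub-mean-value property. -/
theorem PshOnE.subMeanOn_max {n : ℕ} {u : En n → EReal} {U : Set (En n)}
    (hu : PshOnE u U) (hc : ContinuousOn u U) (N : ℝ) :
    SubMeanOn (fun x => (max (u x) (N : EReal)).toReal) U := by
  have hcont := hc.toReal_max hu.2.1 N
  refine ⟨hcont, fun z hz w r hr hd => ?_⟩
  rw [← EReal.coe_le_coe_iff, coe_toReal_max (hu.2.1 z hz)]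
  have hd' : ∀ θ, z + circleMap 0 r θ • w ∈ U := fun θ => hd _ (by simp [abs_of_pos hr])
  refine max_le ?_ ?_
  · refine (hu.2.2 z hz w r hr hd).trans ?_
    rw [← eint_thetaM_circleMap]
    · refine eint_mono_ae (Eventually.of_forall fun θ => ?_)
      rw [coe_toReal_max (hu.2.1 _ (hd' θ))]
      exact le_max_left _ _
    · rw [abs_of_pos hr]
      exact (continuousOn_disc_comp hcont hd).mono sphere_subset_closedBall
  · rw [EReal.coe_le_coe_iff]
    refine (Real.circleAverage_const N 0 r).symm.le.trans ?_
    refine Real.circleAverage_mono (continuousOn_const.circleIntegrable hr.le)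
      (circleIntegrable_disc_comp hcont hr hd) fun ζ hζ => ?_
    rw [abs_of_pos hr, mem_sphere_zero_iff_norm] at hζ
    rw [← EReal.coe_le_coe_iff, coe_toReal_max (hu.2.1 _ (hd ζ hζ.le))]
    exact le_max_right _ _

/-- A positive linear functional on the continuous functions of a compact space is represented by
a measure. -/
theorem exists_measure_of_positive {Y : Type*} [TopologicalSpace Y] [CompactSpace Y] [T2Space Y]
    [MeasurableSpace Y] [BorelSpace Y] (L : C(Y, ℝ) →ₗ[ℝ] ℝ)
    (hL : ∀ f : C(Y, ℝ), (∀ y, 0 ≤ f y) → 0 ≤ L f) :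
    ∃ μ : Measure Y, IsFiniteMeasure μ ∧ ∀ f : C(Y, ℝ), ∫ y, f y ∂μ = L f := by
  let Λ : CompactlySupportedContinuousMap Y ℝ →ₚ[ℝ] ℝ :=
    { toFun := fun g => L g.toContinuousMap
      map_add' := fun g h => L.map_add g.toContinuousMap h.toContinuousMap
      map_smul' := fun c g => L.map_smul c g.toContinuousMap
      monotone' := fun g h hgh => by
        have := hL (h.toContinuousMap - g.toContinuousMap) fun y => sub_nonneg.2 (hgh y)
        rw [map_sub] at this
        exact sub_nonneg.1 this }
  refine ⟨RealRMK.rieszMeasure Λ, inferInstance, fun f => ?_⟩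
  exact RealRMK.integral_rieszMeasure Λ ⟨f, HasCompactSupport.of_compactSpace f⟩

/-- Representing measures on a compact set for a convex cone of continuous functions which
contains the constants and satisfies the maximum principle: the upper envelope at `z` is an
integral against a measure. -/
theorem exists_representing_measure {α : Type*} [TopologicalSpace α] [T2Space α]
    [MeasurableSpace α] [BorelSpace α] {Y : Set α} (hY : IsCompact Y)
    {C : Set (α → ℝ)} (hcont : ∀ v ∈ C, ContinuousOn v Y)
    (hconst : ∀ c : ℝ, (fun _ => c) ∈ C)
    (hadd : ∀ v ∈ C, ∀ w ∈ C, (fun x => v x + w x) ∈ C)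
    (hmul : ∀ c : ℝ, 0 ≤ c → ∀ v ∈ C, (fun x => c * v x) ∈ C)
    {z : α} (hmax : ∀ v ∈ C, (∀ y ∈ Y, v y ≤ 0) → v z ≤ 0)
    {φ : α → ℝ} (hφ : ContinuousOn φ Y) :
    ∃ μ : Measure α, IsProbabilityMeasure μ ∧ μ Yᶜ = 0 ∧ (∀ v ∈ C, v z ≤ ∫ x, v x ∂μ) ∧
      IsLUB {t | ∃ v ∈ C, (∀ y ∈ Y, v y ≤ φ y) ∧ t = v z} (∫ x, φ x ∂μ) := by
  have : CompactSpace Y := isCompact_iff_compactSpace.1 hY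
  let S : C(Y, ℝ) → Set ℝ := fun f => {t | ∃ v ∈ C, (∀ y : Y, v y + f y ≤ 0) ∧ t = -v z}
  let p : C(Y, ℝ) → ℝ := fun f => sInf (S f)
  have hSne : ∀ f, (S f).Nonempty := fun f =>
    ⟨_, _, hconst (-‖f‖), fun y => by
      have := (abs_le.1 (f.norm_coe_le_norm y)).2
      linarith, rfl⟩
  have hShift : ∀ v ∈ C, ∀ c : ℝ, (∀ y ∈ Y, v y ≤ c) → v z ≤ c := by
    intro v hv c h
    have := hmax _ (hadd v hv _ (hconst (-c))) fun y hy => by linarith [h y hy]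
    linarith
  have hSbdd : ∀ f, BddBelow (S f) := fun f => by
    refine ⟨-‖f‖, ?_⟩
    rintro t ⟨v, hv, hvf, rfl⟩
    refine neg_le_neg (hShift v hv _ fun y hy => ?_)
    have := (abs_le.1 (f.norm_coe_le_norm ⟨y, hy⟩)).1
    linarith [hvf ⟨y, hy⟩]
  have hp_le : ∀ f, ∀ v ∈ C, (∀ y : Y, v y + f y ≤ 0) → p f ≤ -v z := fun f v hv h =>
    csInf_le (hSbdd f) ⟨v, hv, h, rfl⟩
  have hp_add : ∀ f g, p (f + g) ≤ p f + p g := by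
    intro f g
    refine le_of_forall_pos_lt_add fun ε hε => ?_
    obtain ⟨_, ⟨v, hv, hvf, rfl⟩, h1⟩ := exists_lt_of_csInf_lt (hSne f)
      (show p f < p f + ε / 2 by linarith)
    obtain ⟨_, ⟨w, hw, hwg, rfl⟩, h2⟩ := exists_lt_of_csInf_lt (hSne g)
      (show p g < p g + ε / 2 by linarith)
    have := hp_le (f + g) _ (hadd v hv w hw) fun y => by
      simp only [ContinuousMap.add_apply]; linarith [hvf y, hwg y]
    linarith
  have hp_mul_le : ∀ c : ℝ, 0 < c → ∀ f, p (c • f) ≤ c * p f := by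
    intro c hc f
    have : (p (c • f)) / c ≤ p f := by
      refine le_csInf (hSne f) ?_
      rintro _ ⟨v, hv, hvf, rfl⟩
      rw [div_le_iff₀ hc]
      have := hp_le (c • f) _ (hmul c hc.le v hv) fun y => by
        simp only [ContinuousMap.smul_apply, smul_eq_mul]
        nlinarith [hvf y]
      linarith
    rwa [div_le_iff₀ hc, mul_comm] at this
  have hp_mul : ∀ c : ℝ, 0 < c → ∀ f, p (c • f) = c * p f := by
    intro c hc f
    refine le_antisymm (hp_mul_le c hc f) ?_
    have := hp_mul_le c⁻¹ (inv_pos.2 hc) (c • f)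
    rw [smul_smul, inv_mul_cancel₀ hc.ne', one_smul, inv_mul_eq_div, le_div_iff₀ hc] at this
    linarith
  have hp0 : p 0 = 0 := by
    have := hp_mul 2 two_pos 0
    rw [smul_zero] at this
    linarith
  let ψ : C(Y, ℝ) := ⟨fun y => -φ y, (continuousOn_iff_continuous_domRestrict.1 hφ).neg⟩
  have hH : ∀ c : ℝ, c • ψ = 0 → (RingHom.id ℝ) c • p ψ = 0 := by
    intro c hc
    rcases smul_eq_zero.1 hc with h | h
    · simp [h]
    · simp [h, hp0]
  obtain ⟨L, hLext, hLle⟩ := exists_extension_of_le_sublinear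
    (LinearPMap.mkSpanSingleton' ψ (p ψ) hH) p hp_mul hp_add (by
      rintro ⟨x, hx⟩
      obtain ⟨c, rfl⟩ := Submodule.mem_span_singleton.1 hx
      rw [LinearPMap.mkSpanSingleton'_apply]
      simp only [RingHom.id_apply, smul_eq_mul]
      rcases lt_trichotomy c 0 with hc | rfl | hc
      · have h1 := hp_mul (-c) (neg_pos.2 hc) ψ
        have h2 := hp_add (c • ψ) ((-c) • ψ)
        rw [← add_smul, add_neg_cancel, zero_smul, hp0] at h2
        linarith
      · simp [hp0]
      · exact (hp_mul c hc ψ).ge)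
  have hLψ : L ψ = p ψ := by
    have := hLext ⟨ψ, Submodule.mem_span_singleton_self ψ⟩
    exact this.trans (LinearPMap.mkSpanSingleton'_apply_self _ _ _ _)
  have hLC : ∀ v ∈ C, ∀ f : C(Y, ℝ), (∀ y : Y, v y ≤ f y) → v z ≤ L f := by
    intro v hv f hvf
    have h1 := hLle (-f)
    rw [map_neg] at h1
    have := hp_le (-f) v hv fun y => by
      simp only [ContinuousMap.neg_apply]; linarith [hvf y]
    linarith
  obtain ⟨ν, hνfin, hν⟩ := exists_measure_of_positive L fun f hf => hLC _ (hconst 0) f hf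
  have hν1 : ν.real univ = 1 := by
    have h1 := hν 1
    have h2 := hLC _ (hconst 1) 1 fun y => by simp
    have h3 := hLC _ (hconst (-1)) (-1) fun y => by simp
    rw [map_neg] at h3
    simp only [ContinuousMap.one_apply, integral_const, smul_eq_mul, mul_one] at h1
    linarith
  have hmeas : MeasurableSet Y := hY.measurableSet
  have hemb : MeasurableEmbedding (Subtype.val : Y → α) := MeasurableEmbedding.subtype_coe hmeas
  have h_int : ∀ f : α → ℝ, ∀ hf : ContinuousOn f Y, ∫ x, f x ∂(ν.map Subtype.val) =
      L ⟨fun y : Y => f y, continuousOn_iff_continuous_domRestrict.1 hf⟩ := by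
    intro f hf
    rw [hemb.integral_map, ← hν]
    rfl
  have hprob : IsProbabilityMeasure ν := ⟨by
    rw [measureReal_def, ENNReal.toReal_eq_one_iff] at hν1
    exact hν1⟩
  refine ⟨ν.map Subtype.val, Measure.isProbabilityMeasure_map hemb.measurable.aemeasurable,
    ?_, fun v hv => ?_, ?_, ?_⟩
  · rw [hemb.map_apply]
    simp
  · rw [h_int v (hcont v hv)]
    exact hLC v hv _ fun y => le_rfl
  · rintro _ ⟨v, hv, hvφ, rfl⟩
    rw [h_int φ hφ]
    exact hLC v hv _ fun y => hvφ y y.2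
  · intro b hb
    have hφψ : ∫ x, φ x ∂(ν.map Subtype.val) = - p ψ := by
      rw [h_int φ hφ, ← hLψ, ← map_neg]
      congr 1
      ext y
      exact (neg_neg (φ y)).symm
    rw [hφψ, neg_le]
    refine le_csInf (hSne ψ) ?_
    rintro _ ⟨v, hv, hvψ, rfl⟩
    refine neg_le_neg (hb ⟨v, hv, fun y hy => ?_, rfl⟩)
    have : v y + -φ y ≤ 0 := hvψ ⟨y, hy⟩
    linarith

/-- The real-valued continuous functions which are plurisubharmonic on a neighborhood of `X`. -/
def nbhdPsh {n : ℕ} (X : Set (En n)) : Set (En n → ℝ) :=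
  {f | ∃ U, IsOpen U ∧ X ⊆ U ∧ SubMeanOn f U}

section NbhdPsh

variable {n : ℕ} {X : Set (En n)} {v w : En n → ℝ}

theorem nbhdPsh_continuousOn (hv : v ∈ nbhdPsh X) : ContinuousOn v X := by
  obtain ⟨U, -, hXU, h⟩ := hv
  exact h.1.mono hXU

theorem const_mem_nbhdPsh (c : ℝ) : (fun _ => c) ∈ nbhdPsh X :=
  ⟨univ, isOpen_univ, subset_univ _, SubMeanOn.const c⟩

theorem re_linear_mem_nbhdPsh (L : En n →L[ℂ] ℂ) : (fun x => (L x).re) ∈ nbhdPsh X :=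
  ⟨univ, isOpen_univ, subset_univ _, SubMeanOn.re_linear L⟩

theorem add_mem_nbhdPsh (hv : v ∈ nbhdPsh X) (hw : w ∈ nbhdPsh X) :
    (fun x => v x + w x) ∈ nbhdPsh X := by
  obtain ⟨U, hU, hXU, h⟩ := hv
  obtain ⟨V, hV, hXV, h'⟩ := hw
  exact ⟨U ∩ V, hU.inter hV, subset_inter hXU hXV,
    (h.mono inter_subset_left).add (h'.mono inter_subset_right)⟩

theorem max_mem_nbhdPsh (hv : v ∈ nbhdPsh X) (hw : w ∈ nbhdPsh X) :
    (fun x => max (v x) (w x)) ∈ nbhdPsh X := by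
  obtain ⟨U, hU, hXU, h⟩ := hv
  obtain ⟨V, hV, hXV, h'⟩ := hw
  exact ⟨U ∩ V, hU.inter hV, subset_inter hXU hXV,
    (h.mono inter_subset_left).max (h'.mono inter_subset_right)⟩

theorem const_mul_mem_nbhdPsh {c : ℝ} (hc : 0 ≤ c) (hv : v ∈ nbhdPsh X) :
    (fun x => c * v x) ∈ nbhdPsh X := by
  obtain ⟨U, hU, hXU, h⟩ := hv
  exact ⟨U, hU, hXU, h.const_mul hc⟩

end NbhdPsh

theorem ContinuousOn.integrable_of_compl_null {α : Type*} [TopologicalSpace α] [T2Space α]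
    [MeasurableSpace α] [BorelSpace α] {X : Set α} (hX : IsCompact X) {f : α → ℝ}
    (hf : ContinuousOn f X) {μ : Measure α} [IsFiniteMeasure μ] (hμ : μ Xᶜ = 0) :
    Integrable f μ := by
  have h := hf.integrableOn_compact' hX hX.measurableSet (μ := μ)
  rwa [IntegrableOn, Measure.restrict_eq_self_of_ae_mem (measure_eq_zero_iff_ae_notMem.1 hμ |>.mono
    fun x hx => not_not.1 hx)] at h

section Jensen

variable {n : ℕ} {X : Set (En n)} {z : En n} {μ : Measure (En n)}

theorem IsJensen.ae_mem (hμ : IsJensen X z μ) : ∀ᵐ x ∂μ, x ∈ X :=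
  (measure_eq_zero_iff_ae_notMem.1 hμ.2.1).mono fun _ hx => not_not.1 hx

theorem IsJensen.integrable (hX : IsCompact X) (hμ : IsJensen X z μ) {f : En n → ℝ}
    (hf : ContinuousOn f X) : Integrable f μ := by
  have := hμ.1
  exact hf.integrable_of_compl_null hX hμ.2.1

theorem IsJensen.le_integral (hX : IsCompact X) (hμ : IsJensen X z μ) {v : En n → ℝ}
    (hv : v ∈ nbhdPsh X) : v z ≤ ∫ x, v x ∂μ := by
  have hi := hμ.integrable hX (nbhdPsh_continuousOn hv)
  obtain ⟨U, hU, hXU, h⟩ := hv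
  have : ((v z : ℝ) : EReal) ≤ eint μ (fun x => (v x : EReal)) :=
    hμ.2.2 U hU hXU _ (continuous_coe_real_ereal.comp_continuousOn h.1) h.pshOnE
  rwa [eint_coe hi, EReal.coe_le_coe_iff] at this

theorem tendsto_epos_neg_max (x : EReal) :
    Tendsto (fun N : ℕ => epos (-(max x ((-(N : ℝ) : ℝ) : EReal)))) atTop (𝓝 (epos (-x))) := by
  induction x with
  | top => simp
  | bot =>
    have : ∀ N : ℕ, epos (-(max ⊥ ((-(N : ℝ) : ℝ) : EReal))) = (N : ℝ≥0∞) := fun N => by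
      rw [max_eq_right bot_le, ← EReal.coe_neg, neg_neg, epos_coe, ENNReal.ofReal_natCast]
    simp only [this]
    simpa [epos] using ENNReal.tendsto_nat_nhds_top
  | coe a =>
    refine tendsto_const_nhds.congr' ?_
    obtain ⟨N₀, hN₀⟩ := exists_nat_ge (-a)
    filter_upwards [eventually_ge_atTop N₀] with N hN
    have : -(N : ℝ) ≤ a := by
      have : (N₀ : ℝ) ≤ N := by exact_mod_cast hN
      linarith
    rw [max_eq_left (EReal.coe_le_coe_iff.2 this)]

/-- Jensen measures can be tested on real-valued functions. -/
theorem isJensen_of_le_integral (hX : IsCompact X) (hz : z ∈ X) [IsProbabilityMeasure μ]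
    (hμX : μ Xᶜ = 0) (h : ∀ v ∈ nbhdPsh X, v z ≤ ∫ x, v x ∂μ) : IsJensen X z μ := by
  refine ⟨inferInstance, hμX, fun U hU hXU u hc hu => ?_⟩
  have hae : ∀ᵐ x ∂μ, x ∈ X :=
    (measure_eq_zero_iff_ae_notMem.1 hμX).mono fun _ hx => not_not.1 hx
  have htop : ∀ x ∈ X, u x < ⊤ := fun x hx => hu.2.1 x (hXU hx)
  have hcoe : ∀ N : ℝ, ∀ x ∈ X,
      (((max (u x) (N : EReal)).toReal : ℝ) : EReal) = max (u x) (N : EReal) :=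
    fun N x hx => coe_toReal_max (htop x hx) N
  have hmem : ∀ N : ℝ, (fun x => (max (u x) (N : EReal)).toReal) ∈ nbhdPsh X := fun N =>
    ⟨U, hU, hXU, hu.subMeanOn_max hc N⟩
  have h_int : ∀ N : ℝ, Integrable (fun x => (max (u x) (N : EReal)).toReal) μ := fun N =>
    (nbhdPsh_continuousOn (hmem N)).integrable_of_compl_null hX hμX
  have hpos : ∀ N : ℕ, ∀ x, epos (max (u x) ((-(N : ℝ) : ℝ) : EReal)) = epos (u x) := fun N x => by
    rw [epos_mono.map_max, max_eq_left]
    rw [epos_coe, ENNReal.ofReal_of_nonpos (by simp)]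
    exact zero_le
  have hP : ∫⁻ x, epos (u x) ∂μ ≠ ⊤ := by
    have h1 : ∫⁻ x, epos (u x) ∂μ =
        ∫⁻ x, ENNReal.ofReal (max (u x) ((0 : ℝ) : EReal)).toReal ∂μ := by
      refine lintegral_congr_ae (hae.mono fun x hx => ?_)
      have := hpos 0 x
      simp only [Nat.cast_zero, neg_zero] at this
      simp only
      rw [← epos_coe, hcoe 0 x hx, this]
    rw [h1]
    exact (h_int 0).lintegral_lt_top.ne
  have hle : ∀ N : ℕ, u z ≤ ((∫⁻ x, epos (u x) ∂μ : ℝ≥0∞) : EReal) -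
      ((∫⁻ x, epos (-(max (u x) ((-(N : ℝ) : ℝ) : EReal))) ∂μ : ℝ≥0∞) : EReal) := fun N => by
    have h1 := EReal.coe_le_coe_iff.2 (h _ (hmem (-(N : ℝ))))
    rw [hcoe _ z hz, ← eint_coe (h_int _), eint_congr_ae (hae.mono fun x hx => hcoe _ x hx),
      eint] at h1
    simp only [hpos N] at h1
    exact (le_max_left _ _).trans h1
  refine ge_of_tendsto' (x := (atTop : Filter ℕ)) ?_ hle
  have hlim : Tendsto (fun N : ℕ => ∫⁻ x, epos (-(max (u x) ((-(N : ℝ) : ℝ) : EReal))) ∂μ) atTop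
      (𝓝 (∫⁻ x, epos (-(u x)) ∂μ)) := by
    refine lintegral_tendsto_of_tendsto_of_monotone (fun N => ?_) ?_ ?_
    · have : AEMeasurable (fun x => ENNReal.ofReal
          (-(max (u x) ((-(N : ℝ) : ℝ) : EReal)).toReal)) μ :=
        (h_int _).neg.aestronglyMeasurable.aemeasurable.ennreal_ofReal
      refine this.congr (hae.mono fun x hx => ?_)
      simp only
      rw [← epos_coe, EReal.coe_neg, hcoe _ x hx]
    · refine Eventually.of_forall fun x N M hNM => epos_mono ?_
      refine EReal.neg_le_neg_iff.2 (max_le_max le_rfl ?_)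
      exact EReal.coe_le_coe_iff.2 (neg_le_neg (by exact_mod_cast hNM))
    · exact Eventually.of_forall fun x => tendsto_epos_neg_max (u x)
  have hlim' := (continuous_coe_ennreal_ereal.tendsto _).comp hlim
  rw [eint]
  simp only [sub_eq_add_neg]
  refine (EReal.continuousAt_add (p := (((∫⁻ x, epos (u x) ∂μ : ℝ≥0∞) : EReal),
    -((∫⁻ x, epos (-(u x)) ∂μ : ℝ≥0∞) : EReal))) (Or.inl ?_) (Or.inl ?_)).tendsto.comp
    (tendsto_const_nhds.prodMk_nhds ((continuous_neg.tendsto _).comp hlim'))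
  · simpa using hP
  · simp

end Jensen

/-- A nonempty compact subset of `X` which carries all the Jensen measures of its points. -/
structure IsJensenFace {n : ℕ} (X F : Set (En n)) : Prop where
  isCompact : IsCompact F
  subset : F ⊆ X
  nonempty : F.Nonempty
  null_compl : ∀ z ∈ F, ∀ μ : Measure (En n), IsJensen X z μ → μ Fᶜ = 0

section Face

variable {n : ℕ} {X F : Set (En n)}

theorem isJensenFace_self (hX : IsCompact X) (hne : X.Nonempty) : IsJensenFace X X :=
  ⟨hX, subset_rfl, hne, fun _ _ _ hμ => hμ.2.1⟩

theorem IsJensenFace.exists_argmax (hX : IsCompact X) (hF : IsJensenFace X F) {v : En n → ℝ}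
    (hv : v ∈ nbhdPsh X) :
    ∃ M : ℝ, (∀ x ∈ F, v x ≤ M) ∧ IsJensenFace X (F ∩ v ⁻¹' {M}) := by
  have hvF : ContinuousOn v F := (nbhdPsh_continuousOn hv).mono hF.subset
  obtain ⟨x₀, hx₀, hmax⟩ := hF.isCompact.exists_isMaxOn hF.nonempty hvF
  refine ⟨v x₀, fun x hx => hmax hx, ?_, inter_subset_left.trans hF.subset, ⟨x₀, hx₀, rfl⟩, ?_⟩
  · exact hF.isCompact.of_isClosed_subset
      (hvF.preimage_isClosed_of_isClosed hF.isCompact.isClosed isClosed_singleton) inter_subset_left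
  · rintro z ⟨hz, hzM⟩ μ hμ
    have := hμ.1
    have hi := hμ.integrable hX (nbhdPsh_continuousOn hv)
    have hFae : ∀ᵐ x ∂μ, x ∈ F :=
      (measure_eq_zero_iff_ae_notMem.1 (hF.null_compl z hz μ hμ)).mono fun _ hx => not_not.1 hx
    have hle := hμ.le_integral hX hv
    rw [show v z = v x₀ from hzM] at hle
    have hnn : 0 ≤ᵐ[μ] fun x => v x₀ - v x := hFae.mono fun x hx => sub_nonneg.2 (hmax hx)
    have hzero : ∫ x, (v x₀ - v x) ∂μ = 0 := by
      refine le_antisymm ?_ (integral_nonneg_of_ae hnn)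
      rw [integral_sub (integrable_const _) hi]
      simpa using hle
    have := (integral_eq_zero_iff_of_nonneg_ae hnn ((integrable_const _).sub hi)).1 hzero
    refine measure_eq_zero_iff_ae_notMem.2 ?_
    filter_upwards [hFae, this] with x hx hx'
    exact not_not.2 ⟨hx, (sub_eq_zero.1 hx').symm⟩

theorem IsJensenFace.exists_constant {ι : Type*} (hX : IsCompact X) (hF : IsJensenFace X F)
    {v : ι → En n → ℝ} (hv : ∀ i, v i ∈ nbhdPsh X) (s : Finset ι) :
    ∃ G ⊆ F, IsJensenFace X G ∧ ∀ i ∈ s, ∀ x ∈ G, ∀ y ∈ G, v i x = v i y := by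
  classical
  induction s using Finset.induction_on with
  | empty => exact ⟨F, subset_rfl, hF, by simp⟩
  | insert i s _ ih =>
    obtain ⟨G, hGF, hG, hcon⟩ := ih
    obtain ⟨M, -, hG'⟩ := hG.exists_argmax hX (hv i)
    refine ⟨_, inter_subset_left.trans hGF, hG', fun j hj x hx y hy => ?_⟩
    rcases Finset.mem_insert.1 hj with rfl | hj
    · exact hx.2.trans hy.2.symm
    · exact hcon j hj x hx.1 y hy.1

theorem IsJensenFace.inter_Oset_nonempty (hX : IsCompact X) (hF : IsJensenFace X F) :
    (F ∩ Oset X).Nonempty := by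
  obtain ⟨G, hGF, hG, hcon⟩ := hF.exists_constant hX
    (v := fun (p : Fin n × Bool) x =>
      (((if p.2 then (1 : ℂ) else Complex.I) • EuclideanSpace.proj (𝕜 := ℂ) p.1 :
        En n →L[ℂ] ℂ) x).re)
    (fun p => re_linear_mem_nbhdPsh _) Finset.univ
  obtain ⟨x, hx⟩ := hG.nonempty
  have huniq : ∀ y ∈ G, y = x := fun y hy => by
    ext i
    have h1 := hcon (i, true) (Finset.mem_univ _) y hy x hx
    have h2 := hcon (i, false) (Finset.mem_univ _) y hy x hx
    simp at h1 h2
    exact Complex.ext h1 h2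
  refine ⟨x, hGF hx, hG.subset hx, fun μ hμ => ?_⟩
  have := hμ.1
  have h0 : ∀ᵐ y ∂μ, y = x :=
    (measure_eq_zero_iff_ae_notMem.1 (hG.null_compl x hx μ hμ)).mono
      fun y hy => huniq y (not_not.1 hy)
  ext s hs
  rw [Measure.dirac_apply' x hs]
  by_cases hxs : x ∈ s
  · rw [indicator_of_mem hxs, Pi.one_apply, ← prob_compl_eq_zero_iff hs]
    exact measure_eq_zero_iff_ae_notMem.2 (h0.mono fun y hy => by simpa [hy] using hxs)
  · rw [indicator_of_notMem hxs]
    exact measure_eq_zero_iff_ae_notMem.2 (h0.mono fun y hy => by simpa [hy] using hxs)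

/-- The maximum principle with respect to `O_X`. -/
theorem nbhdPsh_nonpos_of_Oset (hX : IsCompact X) {z : En n} (hz : z ∈ X) {v : En n → ℝ}
    (hv : v ∈ nbhdPsh X) (h : ∀ x ∈ Oset X, v x ≤ 0) : v z ≤ 0 := by
  obtain ⟨M, hM, hF⟩ := (isJensenFace_self hX ⟨z, hz⟩).exists_argmax hX hv
  obtain ⟨x, hxF, hxO⟩ := hF.inter_Oset_nonempty hX
  exact (hM z hz).trans ((show v x = M from hxF.2) ▸ h x hxO)

/-- Edwards' duality theorem for Jensen measures carried by a compact set containing `O_X`. -/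
theorem exists_isJensen_isLUB (hX : IsCompact X) {z : En n} (hz : z ∈ X) {Y : Set (En n)}
    (hY : IsCompact Y) (hYX : Y ⊆ X) (hOY : Oset X ⊆ Y) {φ : En n → ℝ} (hφ : ContinuousOn φ Y) :
    ∃ μ : Measure (En n), IsJensen X z μ ∧ μ Yᶜ = 0 ∧
      IsLUB {t | ∃ v ∈ nbhdPsh X, (∀ y ∈ Y, v y ≤ φ y) ∧ t = v z} (∫ x, φ x ∂μ) := by
  obtain ⟨μ, hprob, hμY, hle, hlub⟩ := exists_representing_measure hY (C := nbhdPsh X) (z := z)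
    (fun v hv => (nbhdPsh_continuousOn hv).mono hYX) const_mem_nbhdPsh
    (fun v hv w hw => add_mem_nbhdPsh hv hw) (fun c hc v hv => const_mul_mem_nbhdPsh hc hv)
    (fun v hv h => nbhdPsh_nonpos_of_Oset hX hz hv fun x hx => h x (hOY hx)) hφ
  exact ⟨μ, isJensen_of_le_integral hX hz
    (measure_mono_null (compl_subset_compl.2 hYX) hμY) hle, hμY, hlub⟩

end Face

theorem nbhdPsh_pshce {n : ℕ} {X : Set (En n)} (hX : IsCompact X) {v : En n → ℝ}
    (hv : v ∈ nbhdPsh X) : PSHce X (fun x => (v x : EReal)) := by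
  have hc : ContinuousOn (fun x => (v x : EReal)) X :=
    continuous_coe_real_ereal.comp_continuousOn (nbhdPsh_continuousOn hv)
  refine ⟨⟨hc.upperSemicontinuousOn, fun z _ => EReal.coe_lt_top _, fun z _ μ hμ => ?_⟩, hc⟩
  rw [eint_coe (hμ.integrable hX (nbhdPsh_continuousOn hv))]
  exact EReal.coe_le_coe_iff.2 (hμ.le_integral hX hv)

theorem IsJensen.eq_dirac {n : ℕ} {X : Set (En n)} {z : En n} {μ : Measure (En n)}
    (hμ : IsJensen X z μ) (hz : z ∈ Oset X) : μ = Measure.dirac z :=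
  hz.2 μ hμ

/-- A function below a family of functions stable under maxima is, on a compact set, below a
single member of the family. -/
theorem exists_forall_lt_of_isCompact {α : Type*} [TopologicalSpace α] {K : Set α}
    (hK : IsCompact K) {F : Set (α → ℝ)} (hne : F.Nonempty)
    (hmax : ∀ v ∈ F, ∀ w ∈ F, (fun x => max (v x) (w x)) ∈ F)
    (hF : ∀ v ∈ F, ContinuousOn v K) {f : α → ℝ} (hf : ContinuousOn f K)
    (h : ∀ y ∈ K, ∃ v ∈ F, f y < v y) : ∃ v ∈ F, ∀ y ∈ K, f y < v y := by
  refine hK.induction_on (p := fun s => ∃ v ∈ F, ∀ y ∈ s, f y < v y) ?_ ?_ ?_ ?_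
  · exact hne.imp fun v hv => ⟨hv, by simp⟩
  · rintro s t hst ⟨v, hv, h⟩
    exact ⟨v, hv, fun y hy => h y (hst hy)⟩
  · rintro s t ⟨v, hv, h⟩ ⟨w, hw, h'⟩
    exact ⟨_, hmax v hv w hw, fun y hy => hy.elim (fun hy => lt_max_of_lt_left (h y hy))
      fun hy => lt_max_of_lt_right (h' y hy)⟩
  · intro x hx
    obtain ⟨v, hv, hlt⟩ := h x hx
    exact ⟨_, (hf x hx).eventually_lt (hF v hv x hx) hlt, v, hv, fun y hy => hy⟩

section Gluing

variable {n : ℕ} {X W : Set (En n)}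

theorem exists_nbhdPsh_glue (hX : IsCompact X) (hW : IsOpen W) {h w : En n → ℝ}
    (hh : h ∈ nbhdPsh (closure (X ∩ W))) (hw : w ∈ nbhdPsh X)
    (hlt : ∀ x ∈ closure (X ∩ W) \ (X ∩ W), h x < w x) :
    ∃ g ∈ nbhdPsh X, (∀ x ∈ X \ W, g x = w x) ∧ ∀ x ∈ closure (X ∩ W), h x ≤ g x := by
  classical
  set Y := closure (X ∩ W)
  have hYX : Y ⊆ X := closure_minimal inter_subset_left hX.isClosed
  have hY : IsCompact Y := hX.of_isClosed_subset isClosed_closure hYX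
  obtain ⟨U', hU', hYU', h1⟩ := hh
  obtain ⟨U, hU, hXU, h2⟩ := hw
  set P : Set (En n) := {x ∈ U' ∩ U | h x < w x}
  have hP : IsOpen P := by
    have := ((h2.1.mono inter_subset_right).sub
      (h1.1.mono inter_subset_left)).isOpen_inter_preimage (hU'.inter hU) (isOpen_Ioi (a := 0))
    convert this using 1
    ext x
    exact and_congr_right fun _ => sub_pos.symm
  have hdisj : Disjoint (Y \ P) (X \ W) := by
    refine disjoint_left.2 fun x hx hx' => hx.2 ⟨⟨hYU' hx.1, hXU hx'.1⟩, hlt x ⟨hx.1, ?_⟩⟩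
    exact fun hxW => hx'.2 hxW.2
  obtain ⟨A, Q, hA, hQ, hYA, hXQ, hAQ⟩ :=
    SeparatedNhds.of_isCompact_isCompact (hY.diff hP) (hX.diff hW) hdisj
  have hglue := SubMeanOn.glue (f := h) (g := w) ((hA.inter hU').inter hU) hP (hQ.inter hU)
    (hAQ.mono (inter_subset_left.trans inter_subset_left) inter_subset_left)
    (h1.mono (union_subset (inter_subset_left.trans inter_subset_right)
      fun x hx => hx.1.1))
    (h2.mono (union_subset (union_subset inter_subset_right fun x hx => hx.1.2)
      inter_subset_right)) fun x hx => hx.2.le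
  have hcov : ∀ x ∈ Y, x ∈ A ∩ U' ∩ U ∨ x ∈ P := fun x hx => by
    by_cases hxP : x ∈ P
    · exact Or.inr hxP
    · exact Or.inl ⟨⟨hYA ⟨hx, hxP⟩, hYU' hx⟩, hXU (hYX hx)⟩
  refine ⟨_, ⟨_, (((hA.inter hU').inter hU).union hP).union (hQ.inter hU), fun x hx => ?_, hglue⟩,
    fun x hx => if_neg fun hxA => disjoint_left.1 hAQ hxA.1.1 (hXQ hx), fun x hx => ?_⟩
  · by_cases hxW : x ∈ W
    · exact Or.inl (hcov x (subset_closure ⟨hx, hxW⟩))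
    · exact Or.inr ⟨hXQ ⟨hx, hxW⟩, hXU hx⟩
  · rcases hcov x hx with hxA | hxP
    · simp only [if_pos hxA]
      exact le_max_left _ _
    · split_ifs
      · exact le_max_left _ _
      · exact hxP.2.le

/-- Approximation from below by plurisubharmonic functions defined on a neighborhood. -/
theorem PSHce.exists_nbhdPsh {Y : Set (En n)} (hY : IsCompact Y) {v : En n → EReal}
    (hv : PSHce Y v) (c : ℝ) {z : En n} (hz : z ∈ Y) {t : ℝ} (ht : (t : EReal) < v z) :
    ∃ h ∈ nbhdPsh Y, (∀ y ∈ Y, (h y : EReal) ≤ max (v y) (c : EReal)) ∧ t < h z := by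
  have hc := hv.2.toReal_max hv.1.2.1 c
  obtain ⟨μ, hμ, -, hlub⟩ := exists_isJensen_isLUB hY hz hY subset_rfl (fun x hx => hx.1) hc
  have hle : v z ≤ ((∫ x, (max (v x) (c : EReal)).toReal ∂μ : ℝ) : EReal) := by
    refine (hv.1.2.2 z hz μ hμ).trans ?_
    rw [← eint_coe (hμ.integrable hY hc)]
    refine eint_mono_ae (hμ.ae_mem.mono fun x hx => ?_)
    rw [coe_toReal_max (hv.1.2.1 x hx)]
    exact le_max_left _ _
  obtain ⟨_, ⟨h, hh, hhv, rfl⟩, hth⟩ :=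
    (lt_isLUB_iff hlub).1 (EReal.coe_lt_coe_iff.1 (ht.trans_le hle))
  refine ⟨h, hh, fun y hy => ?_, hth⟩
  rw [← coe_toReal_max (hv.1.2.1 y hy)]
  exact EReal.coe_le_coe_iff.2 (hhv y hy)

end Gluing

section Dirichlet

variable {n : ℕ} {X : Set (En n)} {φ : En n → ℝ} {u : En n → EReal}

theorem Bset_subset (hX : IsCompact X) : Bset X ⊆ X :=
  closure_minimal (fun _ hx => hx.1) hX.isClosed

theorem isCompact_Bset (hX : IsCompact X) : IsCompact (Bset X) :=
  hX.of_isClosed_subset isClosed_closure (Bset_subset hX)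

theorem IsJensenB.integrable (hX : IsCompact X) (hφ : ContinuousOn φ (Bset X)) {z : En n}
    {μ : Measure (En n)} (hμ : IsJensenB X z μ) : Integrable φ μ := by
  have := hμ.1.1
  exact hφ.integrable_of_compl_null (isCompact_Bset hX) hμ.2

theorem IsJensenB.ae_mem {z : En n} {μ : Measure (En n)} (hμ : IsJensenB X z μ) :
    ∀ᵐ x ∂μ, x ∈ Bset X :=
  (measure_eq_zero_iff_ae_notMem.1 hμ.2).mono fun _ hx => not_not.1 hx

/-- The upper envelope of the continuous plurisubharmonic functions which are at most `φ` on the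
potential boundary. -/
def IsDirichletEnvelope (X : Set (En n)) (φ : En n → ℝ) (u : En n → EReal) : Prop :=
  ∀ x, u x = ⨆ v ∈ {v : En n → EReal | PSHce X v ∧ ∀ w ∈ Bset X, v w ≤ (φ w : EReal)}, v x

namespace IsDirichletEnvelope

theorem le_eint (hu : IsDirichletEnvelope X φ u) {z : En n} (hz : z ∈ X) {μ : Measure (En n)}
    (hμ : IsJensenB X z μ) : u z ≤ eint μ (fun x => (φ x : EReal)) := by
  rw [hu z]
  exact iSup₂_le fun v hv => (hv.1.1.2.2 z hz μ hμ.1).trans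
    (eint_mono_ae (hμ.ae_mem.mono fun x hx => hv.2 x hx))

theorem coe_le (hu : IsDirichletEnvelope X φ u) (hX : IsCompact X) {v : En n → ℝ}
    (hv : v ∈ nbhdPsh X) (hvφ : ∀ y ∈ Bset X, v y ≤ φ y) (z : En n) : (v z : EReal) ≤ u z := by
  rw [hu z]
  exact le_iSup₂ (f := fun (v : En n → EReal) (_ : v ∈ {v : En n → EReal | PSHce X v ∧
    ∀ w ∈ Bset X, v w ≤ (φ w : EReal)}) => v z) _
    ⟨nbhdPsh_pshce hX hv, fun w hw => EReal.coe_le_coe_iff.2 (hvφ w hw)⟩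

theorem exists_isJensenB (hu : IsDirichletEnvelope X φ u) (hX : IsCompact X)
    (hφ : ContinuousOn φ (Bset X)) {z : En n} (hz : z ∈ X) :
    ∃ μ : Measure (En n), IsJensenB X z μ ∧ u z = ((∫ x, φ x ∂μ : ℝ) : EReal) ∧
      ∀ t : ℝ, (t : EReal) < u z → ∃ v ∈ nbhdPsh X, (∀ y ∈ Bset X, v y ≤ φ y) ∧ t < v z := by
  obtain ⟨μ, hμ, hμB, hlub⟩ := exists_isJensen_isLUB hX hz (isCompact_Bset hX) (Bset_subset hX)
    subset_closure hφ
  have hB : IsJensenB X z μ := ⟨hμ, hμB⟩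
  have hex : ∀ t : ℝ, t < ∫ x, φ x ∂μ →
      ∃ v ∈ nbhdPsh X, (∀ y ∈ Bset X, v y ≤ φ y) ∧ t < v z := fun t ht => by
    obtain ⟨_, ⟨v, hv, hvφ, rfl⟩, htv⟩ := (lt_isLUB_iff hlub).1 ht
    exact ⟨v, hv, hvφ, htv⟩
  have huz : u z = ((∫ x, φ x ∂μ : ℝ) : EReal) := by
    refine le_antisymm ?_ (EReal.ge_of_forall_gt_iff_ge.1 fun t ht => ?_)
    · rw [← eint_coe (hB.integrable hX hφ)]
      exact hu.le_eint hz hB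
    · obtain ⟨v, hv, hvφ, htv⟩ := hex t (EReal.coe_lt_coe_iff.1 ht)
      exact (EReal.coe_le_coe_iff.2 htv.le).trans (hu.coe_le hX hv hvφ z)
  exact ⟨μ, hB, huz, fun t ht => hex t (EReal.coe_lt_coe_iff.1 (huz ▸ ht))⟩

theorem exists_const_le (hX : IsCompact X) (hφ : ContinuousOn φ (Bset X)) :
    ∃ c : ℝ, ∀ y ∈ Bset X, c ≤ φ y := by
  obtain ⟨c, hc⟩ := (isCompact_Bset hX).bddBelow_image hφ
  exact ⟨c, fun y hy => hc ⟨y, hy, rfl⟩⟩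

theorem lowerSemicontinuousOn (hu : IsDirichletEnvelope X φ u) : LowerSemicontinuousOn u X := by
  rw [funext hu]
  exact lowerSemicontinuousOn_biSup fun v hv => hv.1.2.lowerSemicontinuousOn

theorem pshw (hu : IsDirichletEnvelope X φ u) (hX : IsCompact X) (hφ : ContinuousOn φ (Bset X)) :
    PSHw X u := by
  obtain ⟨c, hc⟩ := exists_const_le hX hφ
  refine ⟨{v | PSHce X v ∧ ∀ w ∈ Bset X, v w ≤ (φ w : EReal)}, ⟨fun _ => (c : EReal), ?_⟩,
    fun v hv => hv.1, fun x _ => hu x⟩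
  exact ⟨nbhdPsh_pshce hX (const_mem_nbhdPsh c), fun w hw => EReal.coe_le_coe_iff.2 (hc w hw)⟩

theorem eq_on_Oset (hu : IsDirichletEnvelope X φ u) (hX : IsCompact X)
    (hφ : ContinuousOn φ (Bset X)) {z : En n} (hz : z ∈ Oset X) : u z = (φ z : EReal) := by
  obtain ⟨μ, hμ, huz, -⟩ := hu.exists_isJensenB hX hφ hz.1
  rw [huz, hμ.1.eq_dirac hz, integral_dirac]

theorem tendsto (hu : IsDirichletEnvelope X φ u) (hX : IsCompact X)
    (hφ : ContinuousOn φ (Bset X)) {z : En n} (hz : z ∈ Oset X) :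
    Tendsto u (𝓝[X] z) (𝓝 (φ z : EReal)) := by
  obtain ⟨ψ, hψ⟩ := ContinuousMap.exists_restrict_eq (isCompact_Bset hX).isClosed
    ⟨(Bset X).domRestrict φ, continuousOn_iff_continuous_domRestrict.1 hφ⟩
  have hψφ : ∀ x ∈ Bset X, ψ x = φ x := fun x hx => DFunLike.congr_fun hψ ⟨x, hx⟩
  refine tendsto_order.2 ⟨fun a ha => ?_, fun b hb => ?_⟩
  · rw [← hu.eq_on_Oset hX hφ hz] at ha
    exact hu.lowerSemicontinuousOn z hz.1 a ha
  · obtain ⟨t, ht, htb⟩ := EReal.lt_iff_exists_real_btwn.1 hb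
    obtain ⟨μ, hμ, -, hlub⟩ := exists_isJensen_isLUB hX hz.1 hX subset_rfl (fun _ hx => hx.1)
      (φ := fun x => -ψ x) (by fun_prop)
    rw [hμ.eq_dirac hz, integral_dirac] at hlub
    have ht' : -t < -ψ z := by
      rw [hψφ z (subset_closure hz)]
      exact neg_lt_neg (EReal.coe_lt_coe_iff.1 ht)
    obtain ⟨_, ⟨v, hv, hvψ, rfl⟩, htv⟩ := (lt_isLUB_iff hlub).1 ht'
    filter_upwards [self_mem_nhdsWithin, (nbhdPsh_continuousOn hv z hz.1).eventually_const_lt htv]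
      with x hx hxv
    obtain ⟨ν, hν, hux, -⟩ := hu.exists_isJensenB hX hφ hx
    have hi := hν.1.integrable hX (nbhdPsh_continuousOn hv)
    have : ∫ y, φ y ∂ν ≤ ∫ y, -v y ∂ν :=
      integral_mono_ae (hν.integrable hX hφ) hi.neg (hν.ae_mem.mono fun y hy => by
        have := hvψ y (Bset_subset hX hy)
        rw [hψφ y hy] at this
        simp only
        linarith)
    rw [integral_neg] at this
    have h1 := hν.1.le_integral hX hv
    rw [hux]
    exact (EReal.coe_lt_coe_iff.2 (by linarith)).trans htb

theorem maximalOn (hu : IsDirichletEnvelope X φ u) (hX : IsCompact X)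
    (hφ : ContinuousOn φ (Bset X)) : MaximalOn X (Bset X) u := by
  intro W hW hWB v hv hle z hz
  obtain ⟨c, hc⟩ := exists_const_le hX hφ
  set Y := closure (X ∩ W) with hYdef
  have hYX : Y ⊆ X := closure_minimal inter_subset_left hX.isClosed
  have hY : IsCompact Y := hX.of_isClosed_subset isClosed_closure hYX
  have hdiff : Y \ (X ∩ W) = Y \ W := by
    ext x
    exact and_congr_right fun hx => not_congr (and_iff_right (hYX hx))
  have hBW : Bset X ⊆ X \ W := fun x hx =>
    ⟨Bset_subset hX hx, fun hxW => (hWB ⟨Bset_subset hX hx, hxW⟩).2 hx⟩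
  refine EReal.ge_of_forall_gt_iff_ge.1 fun t ht => ?_
  obtain ⟨s, hts, hs⟩ := EReal.lt_iff_exists_real_btwn.1 ht
  obtain ⟨h, hh, hhv, hsh⟩ := hv.exists_nbhdPsh hY c hz hs
  have hδ : 0 < s - t := sub_pos.2 (EReal.coe_lt_coe_iff.1 hts)
  have hh' : (fun x => h x + (t - s)) ∈ nbhdPsh Y := add_mem_nbhdPsh hh (const_mem_nbhdPsh _)
  obtain ⟨w, ⟨hw, hwφ⟩, hlt⟩ := exists_forall_lt_of_isCompact (K := Y \ (X ∩ W))
    (F := {w | w ∈ nbhdPsh X ∧ ∀ y ∈ Bset X, w y ≤ φ y}) (hdiff ▸ hY.diff hW)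
    ⟨_, const_mem_nbhdPsh c, hc⟩
    (fun v hv w hw => ⟨max_mem_nbhdPsh hv.1 hw.1, fun y hy => max_le (hv.2 y hy) (hw.2 y hy)⟩)
    (fun v hv => (nbhdPsh_continuousOn hv.1).mono (sdiff_subset.trans hYX))
    ((nbhdPsh_continuousOn hh').mono sdiff_subset) fun y hy => by
      obtain ⟨-, -, -, hex⟩ := hu.exists_isJensenB hX hφ (hYX hy.1)
      obtain ⟨w, hw, hwφ, hlt⟩ := hex (h y + (t - s)) <| by
        refine (EReal.coe_lt_coe_iff.2 (show h y + (t - s) < h y by linarith)).trans_le ?_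
        exact (hhv y hy.1).trans (max_le (hle y hy) (hu.coe_le hX (const_mem_nbhdPsh c) hc y))
      exact ⟨w, ⟨hw, hwφ⟩, hlt⟩
  obtain ⟨g, hg, hgw, hhg⟩ := exists_nbhdPsh_glue hX hW hh' hw hlt
  refine le_trans (EReal.coe_le_coe_iff.2 ?_)
    (hu.coe_le hX hg (fun y hy => (hgw y (hBW hy)).trans_le (hwφ y hy)) z)
  have := hhg z hz
  linarith

end IsDirichletEnvelope

end Dirichlet

/-- Theorem 6.3, parts (1)-(5): the maximal solution of the Dirichlet problem. -/
theorem stmt_14 {n : ℕ} (X : Set (En n)) (hX : IsCompact X) (hreg : IsClosed (Oset X))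
    (φ : En n → ℝ) (hφ : ContinuousOn φ (Bset X)) (u : En n → EReal)
    (hu : ∀ x, u x =
      ⨆ v ∈ {v : En n → EReal | PSHce X v ∧ ∀ w ∈ Bset X, v w ≤ (φ w : EReal)}, v x) :
    (LowerSemicontinuousOn u X ∧ PSHw X u) ∧
    (∀ z ∈ X, u z = sInf {t : EReal | ∃ μ : Measure (En n), IsJensenB X z μ ∧
      t = eint μ (fun x => (φ x : EReal))}) ∧
    (∀ z ∈ X, ∃ μ : Measure (En n), IsJensenB X z μ ∧ eint μ u = u z) ∧
    (∀ z0 ∈ Bset X, u z0 = (φ z0 : EReal) ∧ Tendsto u (𝓝[X] z0) (𝓝 (φ z0 : EReal))) ∧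
    MaximalOn X (Bset X) u := by
  replace hu : IsDirichletEnvelope X φ u := hu
  have hB : Bset X = Oset X := hreg.closure_eq
  have heq : ∀ z ∈ Bset X, u z = (φ z : EReal) := fun z hz => hu.eq_on_Oset hX hφ (hB ▸ hz)
  refine ⟨⟨hu.lowerSemicontinuousOn, hu.pshw hX hφ⟩, fun z hz => ?_, fun z hz => ?_,
    fun z hz => ⟨heq z hz, hu.tendsto hX hφ (hB ▸ hz)⟩, hu.maximalOn hX hφ⟩
  · obtain ⟨μ, hμ, huz, -⟩ := hu.exists_isJensenB hX hφ hz
    refine le_antisymm (le_sInf ?_) (sInf_le ⟨μ, hμ, ?_⟩)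
    · rintro _ ⟨ν, hν, rfl⟩
      exact hu.le_eint hz hν
    · rw [huz, eint_coe (hμ.integrable hX hφ)]
  · obtain ⟨μ, hμ, huz, -⟩ := hu.exists_isJensenB hX hφ hz
    refine ⟨μ, hμ, ?_⟩
    rw [eint_congr_ae (hμ.ae_mem.mono heq), eint_coe (hμ.integrable hX hφ), huz]
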